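/- arXiv:1001.3308 — 2 statements merged into one kernel-verified Lean document; each statement's English description precedes it below -/
import Mathlib

section
/- (Multicompound option valuation in the Gaussian model.) Let σ > 0, r ∈ ℝ, x ∈ ℝ, t < T₁ < … < T_N, S_1*, …, S_N* > 0, K_1, …, K_N > 0 and w_1, …, w_N ∈ {−1, 1}. Let X_j = x + (r − σ²/2)(T_j − t) + σ B_j, j = 1, …, N, where (B_1, …, B_N) is a centered Gaussian vector with covariance Cov(B_j, B_k) = min(T_j, T_k) − t; set S = e^x. Then e^{−r(T_N − t)} (∏_{n=1}^N w_n) E[ e^{X_N} ∏_{n=1}^N 1(w_n X_n ≥ w_n ln S_n*) ] − Σ_{j=1}^N e^{−r(T_j − t)} (∏_{n=1}^j w_n) K_j E[ ∏_{n=1}^j 1(w_n X_n ≥ w_n ln S_n*) ] = S (∏_{n=1}^N w_n) N_N((w_1 d_1⁺, …, w_N d_N⁺); Ξ_N) − Σ_{j=1}^N (∏_{n=1}^j w_n) K_j e^{−r(T_j − t)} N_j((w_1 d_1⁻, …, w_j d_j⁻); Ξ_j), where d_j^± = (ln(S/S_j*) + (r ± σ²/2)(T_j − t)) / (σ√(T_j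 − t)) and, for each j, Ξ_j is the j×j matrix with unit diagonal and (m,k)-entry w_m w_k √((T_m − t)/(T_k − t)) for m < k (symmetrically for m > k). -/
open MeasureTheory Real Complex Matrix ProbabilityTheory

/-- `multinormalCDF b Σ` is the probability that a centered Gaussian vector with
(symmetric positive definite) covariance matrix `Σ` satisfies `y k ≤ b k` for all `k`,
expressed via the Gaussian density. -/
noncomputable def multinormalCDF {N : ℕ} (b : Fin N → ℝ) (S : Matrix (Fin N) (Fin N) ℝ) : ℝ :=
  ∫ y in {y : Fin N → ℝ | ∀ k, y k ≤ b k},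
    Real.sqrt (((2 * Real.pi) ^ N * S.det)⁻¹) * Real.exp (-(y ⬝ᵥ S⁻¹.mulVec y) / 2)

/-- `B` is a centered Gaussian vector with covariance matrix `C` (Cramér–Wold
characterization: every linear combination is a centered real Gaussian with the
corresponding variance). -/
def IsCenteredGaussianVector {Ω : Type*} [MeasurableSpace Ω] (P : Measure Ω) {N : ℕ}
    (B : Fin N → Ω → ℝ) (C : Matrix (Fin N) (Fin N) ℝ) : Prop :=
  ∀ c : Fin N → ℝ, Measure.map (fun s => ∑ j, c j * B j s) P
    = gaussianReal 0 (∑ j, ∑ k, c j * c k * C j k).toNNReal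

theorem Measure.pi_gaussianReal_eq_withDensity {ι : Type*} [Fintype ι] :
    Measure.pi (fun _ : ι => gaussianReal 0 1) =
      (volume : Measure (ι → ℝ)).withDensity
        (fun u => ENNReal.ofReal (∏ i, gaussianPDFReal 0 1 (u i))) := by
  refine Measure.pi_eq fun s hs => ?_
  have hint : Integrable (fun u : ι → ℝ => ∏ i, (s i).indicator (gaussianPDFReal 0 1) (u i)) :=
    Integrable.fintype_prod
      (f := fun i => (s i).indicator (gaussianPDFReal 0 1))
      (fun i => (integrable_gaussianPDFReal 0 1).indicator (hs i))
  have hprod : ∀ u : ι → ℝ, (Set.univ.pi s).indicator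
      (fun u => ENNReal.ofReal (∏ i, gaussianPDFReal 0 1 (u i))) u =
      ENNReal.ofReal (∏ i, (s i).indicator (gaussianPDFReal 0 1) (u i)) := by
    intro u
    by_cases hu : u ∈ Set.univ.pi s
    · rw [Set.indicator_of_mem hu]
      congr 1
      exact Finset.prod_congr rfl fun i _ => (Set.indicator_of_mem (hu i trivial) _).symm
    · rw [Set.indicator_of_notMem hu]
      simp only [Set.mem_pi, Set.mem_univ, true_imp_iff, not_forall] at hu
      obtain ⟨i, hi⟩ := hu
      rw [Finset.prod_eq_zero (Finset.mem_univ i) (Set.indicator_of_notMem hi _)]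
      simp
  rw [withDensity_apply _ (MeasurableSet.univ_pi hs),
    ← lintegral_indicator (MeasurableSet.univ_pi hs)]
  simp_rw [hprod]
  rw [← ofReal_integral_eq_lintegral_ofReal hint
    (ae_of_all _ fun u => Finset.prod_nonneg fun i _ =>
      Set.indicator_nonneg (fun y _ => gaussianPDFReal_nonneg 0 1 y) _),
    integral_fintype_prod_volume_eq_prod (fun i => (s i).indicator (gaussianPDFReal 0 1)),
    ENNReal.ofReal_prod_of_nonneg]
  · refine Finset.prod_congr rfl fun i _ => ?_
    rw [integral_indicator (hs i), gaussianReal_apply_eq_integral _ one_ne_zero]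
  · exact fun i _ => integral_nonneg fun y =>
      Set.indicator_nonneg (fun y _ => gaussianPDFReal_nonneg 0 1 y) _

theorem IsCenteredGaussianVector.map_eq_map_pi {Ω : Type*} [MeasurableSpace Ω] {P : Measure Ω}
    [IsProbabilityMeasure P] {n : ℕ} {Z : Fin n → Ω → ℝ} (hZm : ∀ i, Measurable (Z i))
    {M : Matrix (Fin n) (Fin n) ℝ} (hZ : IsCenteredGaussianVector P Z (Mᵀ * M)) :
    P.map (fun s k => Z k s) =
      (Measure.pi fun _ : Fin n => gaussianReal 0 1).map (fun u => Mᵀ *ᵥ u) := by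
  have hZm' : Measurable (fun s k => Z k s) := measurable_pi_lambda _ hZm
  have hMm : Measurable (fun u : Fin n → ℝ => Mᵀ *ᵥ u) :=
    (Continuous.matrix_mulVec continuous_const continuous_id).measurable
  have : IsProbabilityMeasure (P.map (fun s k => Z k s)) :=
    Measure.isProbabilityMeasure_map hZm'.aemeasurable
  refine Measure.ext_of_charFunDual ?_
  ext L
  set c : Fin n → ℝ := fun j => L (Pi.single j 1) with hc
  have hL : ∀ y : Fin n → ℝ, L y = c ⬝ᵥ y := by
    intro y
    conv_lhs => rw [pi_eq_sum_univ' y]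
    simp [dotProduct, hc, map_sum, mul_comm]
  have hquad : ∑ j, ∑ k, c j * c k * (Mᵀ * M) j k = (M *ᵥ c) ⬝ᵥ (M *ᵥ c) := by
    calc _ = c ⬝ᵥ ((Mᵀ * M) *ᵥ c) := by
          simp only [dotProduct, Matrix.mulVec, Finset.mul_sum]
          exact Finset.sum_congr rfl fun j _ => Finset.sum_congr rfl fun k _ => by ring
      _ = _ := by
          rw [← Matrix.mulVec_mulVec, Matrix.dotProduct_mulVec, Matrix.vecMul_transpose]
  have hmap : (P.map (fun s k => Z k s)).map L = P.map (fun s => ∑ j, c j * Z j s) := by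
    rw [Measure.map_map L.continuous.measurable hZm']
    congr 1
    ext s
    simp [hL, dotProduct]
  have hnn : 0 ≤ (M *ᵥ c) ⬝ᵥ (M *ᵥ c) := Finset.sum_nonneg fun i _ => mul_self_nonneg _
  rw [charFunDual_eq_charFun_map_one, hmap, hZ c, hquad, charFun_gaussianReal, charFunDual_apply,
    integral_map hMm.aemeasurable (by fun_prop)]
  have hexp : ∀ u : Fin n → ℝ, Complex.exp (L (Mᵀ *ᵥ u) * Complex.I) =
      ∏ i, Complex.exp (((M *ᵥ c) i : ℂ) * (u i : ℂ) * Complex.I) := by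
    intro u
    rw [hL, Matrix.dotProduct_mulVec, Matrix.vecMul_transpose, ← Complex.exp_sum,
      ← Finset.sum_mul]
    simp [dotProduct]
  simp_rw [hexp]
  rw [integral_fintype_prod_eq_prod
    (f := fun i (x : ℝ) => Complex.exp (((M *ᵥ c) i : ℂ) * (x : ℂ) * Complex.I))]
  simp_rw [← charFun_apply_real, charFun_gaussianReal]
  rw [← Complex.exp_sum, Real.coe_toNNReal _ hnn]
  simp [dotProduct, Finset.sum_div, sq]

/-- The density of the centered Gaussian law with covariance matrix `S`. -/
noncomputable def multinormalPDF {n : ℕ} (S : Matrix (Fin n) (Fin n) ℝ) (y : Fin n → ℝ) : ℝ :=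
  Real.sqrt (((2 * Real.pi) ^ n * S.det)⁻¹) * Real.exp (-(y ⬝ᵥ S⁻¹.mulVec y) / 2)

theorem prod_gaussianPDFReal_eq {n : ℕ} {M : Matrix (Fin n) (Fin n) ℝ} (hM : M.det ≠ 0)
    (u : Fin n → ℝ) :
    ∏ i, gaussianPDFReal 0 1 (u i) = |M.det| * multinormalPDF (Mᵀ * M) (Mᵀ *ᵥ u) := by
  have hu : IsUnit M.det := isUnit_iff_ne_zero.mpr hM
  have hut : IsUnit Mᵀ.det := by rwa [Matrix.det_transpose]
  have hq : (Mᵀ *ᵥ u) ⬝ᵥ ((Mᵀ * M)⁻¹ *ᵥ (Mᵀ *ᵥ u)) = ∑ i, u i ^ 2 := by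
    rw [Matrix.mul_inv_rev, Matrix.mulVec_mulVec, Matrix.mul_assoc, Matrix.nonsing_inv_mul _ hut,
      Matrix.mul_one, Matrix.mulVec_transpose, ← Matrix.dotProduct_mulVec, Matrix.mulVec_mulVec,
      Matrix.mul_nonsing_inv _ hu, Matrix.one_mulVec]
    simp [dotProduct, sq]
  have hdet : Real.sqrt (((2 * Real.pi) ^ n * (Mᵀ * M).det)⁻¹) =
      (Real.sqrt (2 * Real.pi))⁻¹ ^ n * |M.det|⁻¹ := by
    rw [Matrix.det_mul, Matrix.det_transpose, Real.sqrt_inv, Real.sqrt_mul (by positivity),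
      Real.sqrt_mul_self_eq_abs, mul_inv, inv_pow]
    congr 2
    rw [Real.sqrt_eq_iff_mul_self_eq (by positivity) (by positivity), ← mul_pow,
      Real.mul_self_sqrt (by positivity)]
  have : |M.det| ≠ 0 := abs_ne_zero.mpr hM
  rw [multinormalPDF, hq, hdet]
  simp only [gaussianPDFReal, Finset.prod_mul_distrib, ← Real.exp_sum, NNReal.coe_one, mul_one,
    sub_zero, Finset.prod_const, Finset.card_univ, Fintype.card_fin]
  rw [← Finset.sum_div, Finset.sum_neg_distrib]
  field_simp

theorem IsCenteredGaussianVector.integral_comp {Ω : Type*} [MeasurableSpace Ω] {P : Measure Ω}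
    [IsProbabilityMeasure P] {n : ℕ} {Z : Fin n → Ω → ℝ} (hZm : ∀ i, Measurable (Z i))
    {M : Matrix (Fin n) (Fin n) ℝ} (hM : M.det ≠ 0) (hZ : IsCenteredGaussianVector P Z (Mᵀ * M))
    {f : (Fin n → ℝ) → ℝ} (hf : Measurable f) :
    ∫ s, f (fun k => Z k s) ∂P = ∫ y, multinormalPDF (Mᵀ * M) y * f y := by
  have hZm' : Measurable (fun s k => Z k s) := measurable_pi_lambda _ hZm
  have hMm : Measurable (fun u : Fin n → ℝ => Mᵀ *ᵥ u) :=
    (Continuous.matrix_mulVec continuous_const continuous_id).measurable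
  have hMt : Mᵀ.det ≠ 0 := by rwa [Matrix.det_transpose]
  have hpdf : Measurable (multinormalPDF (Mᵀ * M)) := by
    unfold multinormalPDF
    fun_prop
  have hvol := Real.map_matrix_volume_pi_eq_smul_volume_pi hMt
  have hcov : ∫ u : Fin n → ℝ, multinormalPDF (Mᵀ * M) (Mᵀ *ᵥ u) * f (Mᵀ *ᵥ u) =
      |M.det|⁻¹ * ∫ y, multinormalPDF (Mᵀ * M) y * f y := by
    have := integral_map (μ := (volume : Measure (Fin n → ℝ)))
      (φ := Matrix.toLin' Mᵀ) (f := fun y => multinormalPDF (Mᵀ * M) y * f y)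
      hMm.aemeasurable ((hpdf.mul hf).aestronglyMeasurable)
    rw [hvol, integral_smul_measure, Matrix.det_transpose,
      ENNReal.toReal_ofReal (abs_nonneg _), abs_inv] at this
    simpa using this.symm
  rw [← integral_map (μ := P) hZm'.aemeasurable hf.aestronglyMeasurable, hZ.map_eq_map_pi hZm,
    integral_map hMm.aemeasurable hf.aestronglyMeasurable, Measure.pi_gaussianReal_eq_withDensity,
    integral_withDensity_eq_integral_toReal_smul (by fun_prop) (by simp)]
  have : ∀ u : Fin n → ℝ, (ENNReal.ofReal (∏ i, gaussianPDFReal 0 1 (u i))).toReal •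
      f (Mᵀ *ᵥ u) = |M.det| * (multinormalPDF (Mᵀ * M) (Mᵀ *ᵥ u) * f (Mᵀ *ᵥ u)) := by
    intro u
    rw [ENNReal.toReal_ofReal (Finset.prod_nonneg fun i _ => gaussianPDFReal_nonneg 0 1 _),
      prod_gaussianPDFReal_eq hM, smul_eq_mul, mul_assoc]
  simp_rw [this]
  rw [integral_const_mul, hcov, ← mul_assoc, mul_inv_cancel₀ (abs_ne_zero.mpr hM), one_mul]

theorem multinormalPDF_mul_exp {n : ℕ} {M : Matrix (Fin n) (Fin n) ℝ} (hM : M.det ≠ 0)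
    (a y : Fin n → ℝ) :
    multinormalPDF (Mᵀ * M) y * Real.exp (a ⬝ᵥ y) =
      Real.exp (a ⬝ᵥ ((Mᵀ * M) *ᵥ a) / 2) *
        multinormalPDF (Mᵀ * M) (y - (Mᵀ * M) *ᵥ a) := by
  set S := Mᵀ * M with hS
  have hSt : Sᵀ = S := by simp [hS, Matrix.transpose_mul]
  have hu : IsUnit S.det := by
    rw [hS, Matrix.det_mul, Matrix.det_transpose]
    exact (mul_ne_zero hM hM).isUnit
  have h1 : (S *ᵥ a) ⬝ᵥ (S⁻¹ *ᵥ y) = a ⬝ᵥ y := by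
    rw [← Matrix.vecMul_transpose, hSt, ← Matrix.dotProduct_mulVec, Matrix.mulVec_mulVec,
      Matrix.mul_nonsing_inv _ hu, Matrix.one_mulVec]
  have h2 : S⁻¹ *ᵥ (S *ᵥ a) = a := by
    rw [Matrix.mulVec_mulVec, Matrix.nonsing_inv_mul _ hu, Matrix.one_mulVec]
  rw [multinormalPDF, multinormalPDF, mul_assoc, ← Real.exp_add, mul_left_comm, ← Real.exp_add,
    Matrix.mulVec_sub, h2, sub_dotProduct, dotProduct_sub, dotProduct_sub, h1, dotProduct_comm y a,
    dotProduct_comm (S *ᵥ a) a]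
  congr 2
  ring

open Classical in
theorem IsCenteredGaussianVector.integral_exp_mul_indicator {Ω : Type*} [MeasurableSpace Ω]
    {P : Measure Ω} [IsProbabilityMeasure P] {n : ℕ} {Z : Fin n → Ω → ℝ}
    (hZm : ∀ i, Measurable (Z i)) {M : Matrix (Fin n) (Fin n) ℝ} (hM : M.det ≠ 0)
    (hZ : IsCenteredGaussianVector P Z (Mᵀ * M)) (a b : Fin n → ℝ) :
    ∫ s, Real.exp (∑ k, a k * Z k s) * (if ∀ k, Z k s ≤ b k then (1 : ℝ) else 0) ∂P =
      Real.exp (a ⬝ᵥ ((Mᵀ * M) *ᵥ a) / 2) *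
        multinormalCDF (b - (Mᵀ * M) *ᵥ a) (Mᵀ * M) := by
  have hset : ∀ b : Fin n → ℝ, MeasurableSet {y : Fin n → ℝ | ∀ k, y k ≤ b k} := fun b => by
    simp only [Set.ofPred_forall]
    exact MeasurableSet.iInter fun k => measurableSet_le (measurable_pi_apply k) measurable_const
  have hf : Measurable fun y : Fin n → ℝ =>
      Real.exp (∑ k, a k * y k) * (if ∀ k, y k ≤ b k then (1 : ℝ) else 0) :=
    Measurable.mul (by fun_prop) (Measurable.ite (hset b) measurable_const measurable_const)
  set v := (Mᵀ * M) *ᵥ a with hv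
  rw [hZ.integral_comp hZm hM hf, multinormalCDF, ← integral_indicator (hset _),
    ← integral_const_mul]
  conv_rhs => rw [← integral_sub_right_eq_self _ v]
  refine integral_congr_ae (ae_of_all _ fun y => ?_)
  have := multinormalPDF_mul_exp hM a y
  simp only [dotProduct] at this
  simp only [← mul_assoc, this, Set.indicator_apply, Set.mem_ofPred_eq, Pi.sub_apply,
    sub_le_sub_iff_right]
  by_cases h : ∀ k, y k ≤ b k
  · simp only [h, implies_true, if_true, mul_one]
    rfl
  · simp only [h, if_false, mul_zero]

theorem IsCenteredGaussianVector.smul_comp {Ω : Type*} [MeasurableSpace Ω] {P : Measure Ω}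
    {N n : ℕ} {B : Fin N → Ω → ℝ} {C : Matrix (Fin N) (Fin N) ℝ}
    (hB : IsCenteredGaussianVector P B C) (f : Fin n → Fin N) (a : Fin n → ℝ) :
    IsCenteredGaussianVector P (fun i s => a i * B (f i) s)
      (fun i k => a i * a k * C (f i) (f k)) := by
  intro c
  set c' : Fin N → ℝ := fun j => ∑ i, if f i = j then c i * a i else 0 with hc'
  have key : ∀ g : Fin N → ℝ, ∑ j, c' j * g j = ∑ i, c i * a i * g (f i) := by
    intro g
    simp only [hc', Finset.sum_mul, ite_mul, zero_mul]
    rw [Finset.sum_comm]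
    simp
  have h := hB c'
  have h1 : ∀ s, ∑ j, c' j * B j s = ∑ i, c i * (a i * B (f i) s) := fun s => by
    rw [key fun j => B j s]
    simp only [mul_assoc]
  have h2 : ∑ j, ∑ k, c' j * c' k * C j k =
      ∑ i, ∑ k, c i * c k * (a i * a k * C (f i) (f k)) := by
    simp only [mul_assoc, ← Finset.mul_sum]
    simp only [key]
    refine Finset.sum_congr rfl fun i _ => ?_
    rw [Finset.mul_sum, Finset.mul_sum]
    exact Finset.sum_congr rfl fun k _ => by ring
  simpa only [h1, h2] using h

/-- The correlation matrix of `w k * W (τ k)` for a Brownian motion `W` and signs `w k`. -/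
noncomputable def signedBrownianCorr {n : ℕ} (w τ : Fin n → ℝ) : Matrix (Fin n) (Fin n) ℝ :=
  fun m k => if m = k then 1 else if m < k then w m * w k * Real.sqrt (τ m / τ k)
    else w k * w m * Real.sqrt (τ k / τ m)

theorem signedBrownianCorr_apply {n : ℕ} {w τ : Fin n → ℝ} (hw : ∀ i, w i = 1 ∨ w i = -1)
    (hτ : StrictMono τ) (hpos : ∀ i, 0 < τ i) (m k : Fin n) :
    signedBrownianCorr w τ m k =
      w m / Real.sqrt (τ m) * (w k / Real.sqrt (τ k)) * min (τ m) (τ k) := by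
  have hs : ∀ i, 0 < Real.sqrt (τ i) := fun i => Real.sqrt_pos.mpr (hpos i)
  have hsq : ∀ i, Real.sqrt (τ i) ^ 2 = τ i := fun i => Real.sq_sqrt (hpos i).le
  have hm := hs m
  have hk := hs k
  unfold signedBrownianCorr
  split_ifs with h1 h2
  · subst h1
    have hww : w m ^ 2 = 1 := by rcases hw m with h | h <;> simp [h]
    rw [min_self]
    nth_rewrite 3 [← hsq m]
    field_simp
    exact hww.symm
  · rw [min_eq_left (hτ h2).le, Real.sqrt_div (hpos m).le]
    have := hsq m
    field_simp
    linear_combination (w m * w k) * this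
  · rw [min_eq_right (hτ (lt_of_le_of_ne (not_lt.mp h2) (Ne.symm h1))).le,
      Real.sqrt_div (hpos k).le]
    have := hsq k
    field_simp
    linear_combination (w m * w k) * this

theorem exists_signedBrownianCorr_eq_transpose_mul {n : ℕ} {w τ : Fin n → ℝ}
    (hw : ∀ i, w i = 1 ∨ w i = -1) (hτ : StrictMono τ) (hpos : ∀ i, 0 < τ i) :
    ∃ M : Matrix (Fin n) (Fin n) ℝ, M.det ≠ 0 ∧ signedBrownianCorr w τ = Mᵀ * M := by
  set F : ℕ → ℝ := fun i =>
    if i = 0 then 0 else if h : i - 1 < n then τ ⟨i - 1, h⟩ else 0 with hF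
  have hFs : ∀ i : Fin n, F (i + 1) = τ i := fun i => by simp [hF]
  have hinc : ∀ i : Fin n, 0 < F (i + 1) - F i := by
    intro i
    rw [hFs]
    rcases Nat.eq_zero_or_pos i.1 with h | h
    · simp [hF, h, hpos i]
    · have hlt : i.1 - 1 < n := by omega
      have : F i = τ ⟨i.1 - 1, hlt⟩ := by simp [hF, h.ne', hlt]
      rw [this, sub_pos]
      exact hτ (Fin.lt_def.mpr (by simp; omega))
  have hsum : ∀ j : Fin n, (∑ i : Fin n, if i ≤ j then F (i + 1) - F i else 0) = τ j := by
    intro j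
    have h := Fin.sum_univ_eq_sum_range (fun i => if i ≤ j.1 then F (i + 1) - F i else 0) n
    simp only [← Fin.le_def] at h
    rw [h, ← Finset.sum_filter]
    have hfil : (Finset.range n).filter (fun i => i ≤ j.1) = Finset.range (j.1 + 1) := by
      ext i
      have := j.2
      simp only [Finset.mem_filter, Finset.mem_range]
      omega
    rw [hfil, Finset.sum_range_sub, hFs]
    simp [hF]
  set M : Matrix (Fin n) (Fin n) ℝ := fun i j =>
    if i ≤ j then Real.sqrt (F (i + 1) - F i) * (w j / Real.sqrt (τ j)) else 0 with hM
  have hMa : ∀ i j, M i j =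
      if i ≤ j then Real.sqrt (F (i + 1) - F i) * (w j / Real.sqrt (τ j)) else 0 := fun _ _ => rfl
  refine ⟨M, ?_, ?_⟩
  · have htri : M.BlockTriangular id := fun i j hij => by
      have : ¬ i ≤ j := not_le.mpr hij
      simp [hM, this]
    rw [Matrix.det_of_isUpperTriangular htri]
    refine Finset.prod_ne_zero_iff.mpr fun i _ => ?_
    have hwi : w i ≠ 0 := by rcases hw i with h | h <;> simp [h]
    simp only [hM, le_refl, if_true]
    exact mul_ne_zero (Real.sqrt_pos.mpr (hinc i)).ne'
      (div_ne_zero hwi (Real.sqrt_pos.mpr (hpos i)).ne')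
  · ext j k
    rw [signedBrownianCorr_apply hw hτ hpos, Matrix.mul_apply, ← hτ.monotone.map_min, ← hsum (min j k),
      Finset.mul_sum]
    refine Finset.sum_congr rfl fun i _ => ?_
    rw [Matrix.transpose_apply, hMa, hMa]
    simp only [le_min_iff]
    by_cases h1 : i ≤ j <;> by_cases h2 : i ≤ k <;> simp only [h1, h2, if_true, if_false,
      and_true, and_false, mul_zero, zero_mul, and_self]
    have := Real.mul_self_sqrt (hinc i).le
    linear_combination (-(w j / Real.sqrt (τ j) * (w k / Real.sqrt (τ k)))) * this

/-- Exponentially weighted probability that a drifted Brownian motion lies, at each time `τ k`,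
above (`w k = 1`) or below (`w k = -1`) the level `l k`. -/
theorem integral_exp_mul_indicator_brownian {Ω : Type*} [MeasurableSpace Ω] {P : Measure Ω}
    [IsProbabilityMeasure P] {n : ℕ} {B : Fin n → Ω → ℝ} (hBm : ∀ i, Measurable (B i))
    {w τ : Fin n → ℝ} (hw : ∀ i, w i = 1 ∨ w i = -1) (hτ : StrictMono τ) (hpos : ∀ i, 0 < τ i)
    (hB : IsCenteredGaussianVector P B (fun j k => min (τ j) (τ k))) {σ : ℝ} (hσ : 0 < σ)
    (x μ θ : ℝ) (l : Fin n → ℝ) (m : Fin n) :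
    ∫ s, Real.exp (θ * σ * B m s) *
        ∏ k, (if w k * (x + μ * τ k + σ * B k s) ≥ w k * l k then (1 : ℝ) else 0) ∂P =
      Real.exp (θ ^ 2 * σ ^ 2 * τ m / 2) *
        multinormalCDF
          (fun k => w k * ((x - l k + μ * τ k + θ * σ ^ 2 * min (τ k) (τ m)) /
            (σ * Real.sqrt (τ k))))
          (signedBrownianCorr w τ) := by
  classical
  obtain ⟨M, hM, hS⟩ := exists_signedBrownianCorr_eq_transpose_mul hw hτ hpos
  have hs : ∀ i, 0 < Real.sqrt (τ i) := fun i => Real.sqrt_pos.mpr (hpos i)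
  have hww : ∀ i, w i * w i = 1 := fun i => by rcases hw i with h | h <;> simp [h]
  set Z : Fin n → Ω → ℝ := fun k s => -(w k / Real.sqrt (τ k)) * B k s with hZdef
  have hZ : IsCenteredGaussianVector P Z (Mᵀ * M) := by
    rw [← hS]
    have hcov : signedBrownianCorr w τ = fun j k =>
        -(w j / Real.sqrt (τ j)) * -(w k / Real.sqrt (τ k)) * min (τ j) (τ k) := by
      ext j k
      rw [signedBrownianCorr_apply hw hτ hpos, neg_mul_neg]
    rw [hcov]
    exact hB.smul_comp id (fun k => -(w k / Real.sqrt (τ k)))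
  have hZm : ∀ i, Measurable (Z i) := fun i => (hBm i).const_mul _
  set c : ℝ := -(θ * σ * w m * Real.sqrt (τ m)) with hc
  have hmul : (Mᵀ * M) *ᵥ (Pi.single m c) =
      fun k => -(θ * σ * w k * min (τ k) (τ m) / Real.sqrt (τ k)) := by
    ext k
    have := hs m
    have := hs k
    rw [Matrix.mulVec_single, ← hS]
    simp only [Matrix.col_apply, Pi.smul_apply, MulOpposite.smul_eq_mul_unop,
      MulOpposite.unop_op, signedBrownianCorr_apply hw hτ hpos, hc]
    field_simp
    linear_combination (-(θ * w k * min (τ k) (τ m))) * hww m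
  have hquad : Pi.single m c ⬝ᵥ ((Mᵀ * M) *ᵥ (Pi.single m c)) = θ ^ 2 * σ ^ 2 * τ m := by
    have := hs m
    rw [hmul, single_dotProduct, min_self, hc]
    field_simp
    linear_combination (θ ^ 2 * τ m) * hww m
  have h := hZ.integral_exp_mul_indicator hZm hM (Pi.single m c)
    (fun k => w k * ((x - l k + μ * τ k) / (σ * Real.sqrt (τ k))))
  rw [hquad, hmul, ← hS] at h
  convert h using 1
  · refine integral_congr_ae (ae_of_all _ fun s => ?_)
    have hexp : θ * σ * B m s = ∑ k, (Pi.single m c : Fin n → ℝ) k * Z k s := by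
      have := hs m
      rw [Finset.sum_eq_single m (fun k _ hk => by simp [hk]) (by simp)]
      simp only [Pi.single_eq_same, hc, hZdef]
      field_simp
      linear_combination (-(θ * B m s)) * hww m
    have hiff : ∀ k, w k * (x + μ * τ k + σ * B k s) ≥ w k * l k ↔
        Z k s ≤ w k * ((x - l k + μ * τ k) / (σ * Real.sqrt (τ k))) := by
      intro k
      have hp : 0 < σ * Real.sqrt (τ k) := mul_pos hσ (hs k)
      have := hs k
      have e : w k * ((x - l k + μ * τ k) / (σ * Real.sqrt (τ k))) - Z k s =
          (w k * (x + μ * τ k + σ * B k s) - w k * l k) / (σ * Real.sqrt (τ k)) := by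
        simp only [hZdef]
        field_simp
        ring
      rw [ge_iff_le, ← sub_nonneg, ← sub_nonneg (b := Z k s), e]
      rw [le_div_iff₀ hp, zero_mul]
    simp only [hexp, hiff, Finset.prod_boole, Finset.mem_univ, true_imp_iff]
  · congr 2
    ext k
    have := hs k
    simp only [Pi.sub_apply]
    field_simp
    ring

theorem signedBrownianCorr_submatrix {m n : ℕ} (w τ : Fin n → ℝ) (h : m ≤ n) :
    (signedBrownianCorr w τ).submatrix (Fin.castLE h) (Fin.castLE h) =
      signedBrownianCorr (w ∘ Fin.castLE h) (τ ∘ Fin.castLE h) := by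
  ext i j
  simp [signedBrownianCorr, Fin.castLE_inj, Fin.castLE_lt_castLE_iff]

theorem prod_Iic_eq_prod_castLE {n : ℕ} (j : Fin n) (f : Fin n → ℝ) :
    ∏ i ∈ Finset.Iic j, f i = ∏ m : Fin (j.1 + 1), f (Fin.castLE j.isLt m) := by
  symm
  refine Finset.prod_bij (fun m _ => Fin.castLE j.isLt m) (fun m _ => ?_)
    (fun a _ b _ hab => Fin.castLE_injective _ hab) (fun i hi => ?_) (fun _ _ => rfl)
  · exact Finset.mem_Iic.mpr (Fin.le_def.mpr (Nat.lt_succ_iff.mp m.2))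
  · exact ⟨⟨i.1, Nat.lt_succ_iff.mpr (Fin.le_def.mp (Finset.mem_Iic.mp hi))⟩,
      Finset.mem_univ _, rfl⟩

/-- Multicompound option valuation in the Gaussian model (the paper's `N` is `N + 1`). -/
theorem stmt17 {Ω : Type*} [MeasurableSpace Ω] (P : Measure Ω) [IsProbabilityMeasure P]
    {N : ℕ} (σ r x t : ℝ) (hσ : 0 < σ) (T : Fin (N + 1) → ℝ) (hT : StrictMono T)
    (ht : t < T 0) (Sstar K : Fin (N + 1) → ℝ) (w : Fin (N + 1) → ℝ)
    (hSstar : ∀ n, 0 < Sstar n) (hK : ∀ n, 0 < K n) (hw : ∀ n, w n = 1 ∨ w n = -1)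
    (B : Fin (N + 1) → Ω → ℝ) (hBmeas : ∀ n, Measurable (B n))
    (hB : IsCenteredGaussianVector P B (fun j k => min (T j) (T k) - t))
    (X : Fin (N + 1) → Ω → ℝ)
    (hX : ∀ j s, X j s = x + (r - σ ^ 2 / 2) * (T j - t) + σ * B j s) :
    Real.exp (-r * (T (Fin.last N) - t)) * (∏ n, w n) *
        (∫ s, Real.exp (X (Fin.last N) s) *
          ∏ n, (if w n * X n s ≥ w n * Real.log (Sstar n) then (1 : ℝ) else 0) ∂P)
      - ∑ j : Fin (N + 1), Real.exp (-r * (T j - t)) * (∏ n ∈ Finset.Iic j, w n) * K j *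
          (∫ s, ∏ n ∈ Finset.Iic j,
            (if w n * X n s ≥ w n * Real.log (Sstar n) then (1 : ℝ) else 0) ∂P)
      = Real.exp x * (∏ n, w n) *
          multinormalCDF
            (fun n => w n * ((Real.log (Real.exp x / Sstar n)
                + (r + σ ^ 2 / 2) * (T n - t)) / (σ * Real.sqrt (T n - t))))
            (fun m k => if m = k then 1 else if m < k then
                w m * w k * Real.sqrt ((T m - t) / (T k - t))
              else w k * w m * Real.sqrt ((T k - t) / (T m - t)))
        - ∑ j : Fin (N + 1), (∏ n ∈ Finset.Iic j, w n) * K j * Real.exp (-r * (T j - t)) *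
            multinormalCDF
              (fun m : Fin (j.1 + 1) => w (Fin.castLE j.isLt m) *
                ((Real.log (Real.exp x / Sstar (Fin.castLE j.isLt m))
                    + (r - σ ^ 2 / 2) * (T (Fin.castLE j.isLt m) - t))
                  / (σ * Real.sqrt (T (Fin.castLE j.isLt m) - t))))
              (Matrix.submatrix
                (fun m k => if m = k then 1 else if m < k then
                    w m * w k * Real.sqrt ((T m - t) / (T k - t))
                  else w k * w m * Real.sqrt ((T k - t) / (T m - t)))
                (Fin.castLE j.isLt) (Fin.castLE j.isLt)) := by
  set τ : Fin (N + 1) → ℝ := fun n => T n - t with hτdef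
  have hτ : StrictMono τ := fun a b hab => sub_lt_sub_right (hT hab) t
  have hpos : ∀ i, 0 < τ i := fun i =>
    sub_pos.mpr (ht.trans_le (hT.monotone (Fin.zero_le i)))
  have hB' : IsCenteredGaussianVector P B (fun j k => min (τ j) (τ k)) := by
    simpa only [hτdef, min_sub_sub_right] using hB
  have hlog : ∀ n, Real.log (Real.exp x / Sstar n) = x - Real.log (Sstar n) := fun n => by
    rw [Real.log_div (Real.exp_pos x).ne' (hSstar n).ne', Real.log_exp]
  have hassetOrNothing : ∫ s, Real.exp (X (Fin.last N) s) *
      ∏ n, (if w n * X n s ≥ w n * Real.log (Sstar n) then (1 : ℝ) else 0) ∂P =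
      Real.exp (r * τ (Fin.last N)) * (Real.exp x * multinormalCDF
        (fun n => w n * ((Real.log (Real.exp x / Sstar n) + (r + σ ^ 2 / 2) * τ n) /
          (σ * Real.sqrt (τ n)))) (signedBrownianCorr w τ)) := by
    have h := integral_exp_mul_indicator_brownian hBmeas hw hτ hpos hB' hσ x (r - σ ^ 2 / 2) 1
      (fun n => Real.log (Sstar n)) (Fin.last N)
    have hexp : ∀ s, Real.exp (X (Fin.last N) s) =
        Real.exp (x + (r - σ ^ 2 / 2) * τ (Fin.last N)) *
          Real.exp (1 * σ * B (Fin.last N) s) := fun s => by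
      rw [← Real.exp_add, hX, one_mul]
    simp only [hexp, mul_assoc (Real.exp (x + _)), integral_const_mul]
    simp only [hX]
    rw [h]
    simp only [← mul_assoc, ← Real.exp_add]
    congr 2
    · ring
    · ext n
      rw [hlog, min_eq_left (hτ.monotone (Fin.le_last n))]
      congr 2
      ring
  have hcashOrNothing : ∀ j : Fin (N + 1), ∫ s, ∏ n ∈ Finset.Iic j,
      (if w n * X n s ≥ w n * Real.log (Sstar n) then (1 : ℝ) else 0) ∂P =
      multinormalCDF
        (fun m : Fin (j.1 + 1) => w (Fin.castLE j.isLt m) *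
          ((Real.log (Real.exp x / Sstar (Fin.castLE j.isLt m)) +
            (r - σ ^ 2 / 2) * τ (Fin.castLE j.isLt m)) /
              (σ * Real.sqrt (τ (Fin.castLE j.isLt m)))))
        ((signedBrownianCorr w τ).submatrix (Fin.castLE j.isLt) (Fin.castLE j.isLt)) := by
    intro j
    have hBj : IsCenteredGaussianVector P (fun m => B (Fin.castLE j.isLt m))
        (fun m k => min (τ (Fin.castLE j.isLt m)) (τ (Fin.castLE j.isLt k))) := by
      simpa using hB'.smul_comp (Fin.castLE j.isLt) (fun _ => 1)
    have h := integral_exp_mul_indicator_brownian (w := w ∘ Fin.castLE j.isLt)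
      (τ := τ ∘ Fin.castLE j.isLt) (fun m => hBmeas _) (fun m => hw _)
      (hτ.comp (Fin.strictMono_castLE _)) (fun m => hpos _) hBj hσ x (r - σ ^ 2 / 2) 0
      (fun m => Real.log (Sstar (Fin.castLE j.isLt m))) 0
    rw [signedBrownianCorr_submatrix]
    simp only [prod_Iic_eq_prod_castLE, hX, hlog]
    simpa using h
  rw [hassetOrNothing]
  simp only [hcashOrNothing]
  have hdisc : Real.exp (-r * τ (Fin.last N)) * Real.exp (r * τ (Fin.last N)) = 1 := by
    rw [← Real.exp_add]
    simp
  refine congrArg₂ (· - ·) ?_ (Finset.sum_congr rfl fun j _ => ?_)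
  · change Real.exp (-r * τ (Fin.last N)) * (∏ n, w n) * (Real.exp (r * τ (Fin.last N)) *
      (Real.exp x * multinormalCDF _ (signedBrownianCorr w τ))) =
      Real.exp x * (∏ n, w n) * multinormalCDF _ (signedBrownianCorr w τ)
    linear_combination ((∏ n, w n) * Real.exp x * multinormalCDF
      (fun n => w n * ((Real.log (Real.exp x / Sstar n) + (r + σ ^ 2 / 2) * τ n) /
        (σ * Real.sqrt (τ n)))) (signedBrownianCorr w τ)) * hdisc
  · rw [mul_assoc (Real.exp _), mul_comm (Real.exp _)]
    rfl
end

section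
/- (Factorization of a lookback term in the Gaussian case.) Let σ > 0, r ∈ ℝ, t < T₁ < … < T_M, w ∈ {−1, 1}, 1 ≤ p ≤ M, and ω_n > 0 for n ∈ {1, …, M} \ {p}. Define ψ_G(ξ) = i(σ²/2 − r)ξ + (σ²/2)ξ². Then, with T₀ = t, (∏_{n ≠ p} w)/(2πi)^{M−1} · ∫_{Im ξ_n = −wω_n, n ≠ p} ( ∏_{n ≠ p} ξ_n )^{−1} exp( − Σ_{j=1}^p (T_j − T_{j−1}) ψ_G(Σ_{n < j, n ≠ p} ξ_n − i) − Σ_{j=p+1}^M (T_j − T_{j−1}) ψ_G(−Σ_{n ≥ j} ξ_n) ) dξ (an absolutely convergent (M−1)-fold contour integral over the indicated lines) equals e^{r(T_p − t)} · N_{p−1}((w g_{p,1}⁺, …, w g_{p,p−1}⁺); Δ_p) · N_{M−p}((w h_{p,p+1}, …, w h_{p,M}); Θ_p), where g_{p,n}⁺ = (r/σ + σ/2)√(T_p − T_n) for n < p, h_{p,n} = (σ/2 − r/σ)√(T_n − T_p) for n > p, Δ_p is the (p−1)×(p−1) matrix with unit diagonal whose (m,n)-entry for m < n is √((T_p − T_n)/(T_p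 − T_m)), and Θ_p is the (M−p)×(M−p) matrix (indexed by n, m ∈ {p+1, …, M}) with unit diagonal whose (n,m)-entry for n < m is √((T_n − T_p)/(T_m − T_p)). -/
open MeasureTheory Real Complex Matrix

/-- The embedding of `{1, …, M − p − 1}` into `Fin M` sending `k` to `p + 1 + k`
(the indices strictly above `p`). -/
def shiftEmb (M : ℕ) (p : Fin M) (k : Fin (M - p.1 - 1)) : Fin M :=
  ⟨p.1 + 1 + k.1, by have hk := k.isLt; have hp := p.isLt; omega⟩

section Gaussian
variable {ι : Type*} [Fintype ι]

theorem gaussian_exponent_shift (M : Matrix ι ι ℝ) (v : ι → ℝ) (c : ι → ℂ) (u : ι → ℝ) :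
    cexp (I * ∑ k, c k * ∑ n, (M k n : ℂ) * (u n - v n * I)
        - (∑ k, (∑ n, (M k n : ℂ) * (u n - v n * I)) ^ 2) / 2)
      = cexp (∑ k, (c k * (M *ᵥ v) k + ((M *ᵥ v) k : ℂ) ^ 2 / 2)) *
        cexp (-(1 / 2 : ℂ) * ∑ k, ((M *ᵥ u) k : ℂ) ^ 2
          + ∑ k, (I * (c k + (M *ᵥ v) k)) * ((M *ᵥ u) k : ℂ)) := by
  have h (k : ι) : ∑ n, (M k n : ℂ) * (u n - v n * I)
      = ((M *ᵥ u) k : ℂ) - ((M *ᵥ v) k : ℂ) * I := by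
    simp only [mulVec, dotProduct, ofReal_sum, ofReal_mul, mul_sub, Finset.sum_sub_distrib,
      Finset.sum_mul, mul_assoc]
  simp only [h]
  rw [← Complex.exp_add]
  congr 1
  simp only [Finset.mul_sum, Finset.sum_div, ← Finset.sum_sub_distrib, ← Finset.sum_add_distrib]
  refine Finset.sum_congr rfl fun k _ => ?_
  linear_combination (-(c k) * (M *ᵥ v) k - ((M *ᵥ v) k : ℂ) ^ 2 / 2) * I_sq

variable [DecidableEq ι]

theorem integral_comp_mulVec {M : Matrix ι ι ℝ} (hM : M.det ≠ 0) (f : (ι → ℝ) → ℂ) :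
    ∫ u, f (M *ᵥ u) = (|M.det|⁻¹ : ℝ) * ∫ u, f u := by
  let e := (LinearEquiv.ofIsUnitDet (f := M.toLin') (v := Pi.basisFun ℝ ι)
    (v' := Pi.basisFun ℝ ι) (by simpa using hM)).toContinuousLinearEquiv
  have he : MeasurableEmbedding (M.toLin' : (ι → ℝ) → ι → ℝ) :=
    e.toHomeomorph.measurableEmbedding
  have h := he.integral_map (μ := volume) f
  rw [Real.map_matrix_volume_pi_eq_smul_volume_pi hM, integral_smul_measure] at h
  rw [ENNReal.toReal_ofReal (abs_nonneg _), abs_inv] at h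
  simpa using h.symm

theorem integrable_comp_mulVec {M : Matrix ι ι ℝ} (hM : M.det ≠ 0) {f : (ι → ℝ) → ℂ}
    (hf : Integrable f) : Integrable (fun u => f (M *ᵥ u)) := by
  let e := (LinearEquiv.ofIsUnitDet (f := M.toLin') (v := Pi.basisFun ℝ ι)
    (v' := Pi.basisFun ℝ ι) (by simpa using hM)).toContinuousLinearEquiv
  have he : MeasurableEmbedding (M.toLin' : (ι → ℝ) → ι → ℝ) :=
    e.toHomeomorph.measurableEmbedding
  refine he.integrable_map_iff (μ := volume) (g := f) |>.1 ?_
  rw [Real.map_matrix_volume_pi_eq_smul_volume_pi hM]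
  exact hf.smul_measure ENNReal.ofReal_ne_top

theorem integrable_cexp_gaussian_shift {M : Matrix ι ι ℝ} (hM : M.det ≠ 0) (v : ι → ℝ)
    (c : ι → ℂ) :
    Integrable fun u : ι → ℝ => cexp (I * ∑ k, c k * ∑ n, (M k n : ℂ) * (u n - v n * I)
        - (∑ k, (∑ n, (M k n : ℂ) * (u n - v n * I)) ^ 2) / 2) := by
  simp only [gaussian_exponent_shift]
  refine Integrable.const_mul ?_ _
  exact integrable_comp_mulVec hM
    (GaussianFourier.integrable_cexp_neg_mul_sum_add (b := 1 / 2) (by norm_num) _)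

theorem integral_cexp_gaussian_shift {M : Matrix ι ι ℝ} (hM : M.det ≠ 0) (v : ι → ℝ)
    (c : ι → ℂ) :
    ∫ u : ι → ℝ, cexp (I * ∑ k, c k * ∑ n, (M k n : ℂ) * (u n - v n * I)
        - (∑ k, (∑ n, (M k n : ℂ) * (u n - v n * I)) ^ 2) / 2)
      = ((√(2 * π) ^ Fintype.card ι * |M.det|⁻¹ : ℝ) : ℂ) * cexp (-(∑ k, c k ^ 2) / 2) := by
  simp only [gaussian_exponent_shift]
  rw [integral_const_mul, integral_comp_mulVec hM (fun y =>
      cexp (-(1 / 2 : ℂ) * ∑ k, (y k : ℂ) ^ 2 + ∑ k, (I * (c k + (M *ᵥ v) k)) * (y k : ℂ))),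
    GaussianFourier.integral_cexp_neg_mul_sum_add (b := 1 / 2) (by norm_num)]
  have h1 : ((π : ℂ) / (1 / 2)) ^ (Fintype.card ι / 2 : ℂ)
      = ((√(2 * π) ^ Fintype.card ι : ℝ) : ℂ) := by
    rw [Real.sqrt_eq_rpow, ← Real.rpow_mul_natCast (by positivity), ofReal_cpow (by positivity)]
    congr 1
    · push_cast; ring
    · push_cast; ring
  rw [h1, mul_left_comm, mul_left_comm (cexp _), ← Complex.exp_add, ofReal_mul]
  rw [← mul_assoc, mul_comm ((|M.det|⁻¹ : ℝ) : ℂ)]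
  congr 2
  simp only [Finset.sum_div, ← Finset.sum_neg_distrib, ← Finset.sum_add_distrib]
  refine Finset.sum_congr rfl fun k _ => ?_
  linear_combination (1 / 2 * (c k + (M *ᵥ v) k) ^ 2) * I_sq

end Gaussian

open scoped MatrixOrder Matrix.Norms.L2Operator in
theorem Matrix.PosDef.exists_det_ne_zero_transpose_mul_self {ι : Type*} [Fintype ι] [DecidableEq ι]
    {C : Matrix ι ι ℝ} (hC : C.PosDef) : ∃ B : Matrix ι ι ℝ, B.det ≠ 0 ∧ C = Bᵀ * B := by
  obtain ⟨B, hB, hCB⟩ := CStarAlgebra.isStrictlyPositive_iff_eq_star_mul_self.1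
    hC.isStrictlyPositive
  refine ⟨B, ((isUnit_iff_isUnit_det B).1 hB).ne_zero, ?_⟩
  rw [hCB, star_eq_conjTranspose, conjTranspose_eq_transpose_of_trivial]

/-- The Fourier integrand of an orthant probability for a Gaussian vector with covariances
`s m * C m n * s n` and means `b n * s n`. -/
noncomputable def orthantIntegrand {N : ℕ} (C : Matrix (Fin N) (Fin N) ℝ) (s b v u : Fin N → ℝ) :
    ℂ :=
  (∏ n, ((u n : ℂ) - (v n : ℝ) * I))⁻¹ *
    cexp (I * ∑ n, (b n : ℂ) * s n * ((u n : ℂ) - (v n : ℝ) * I)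
      - (∑ m, ∑ n, (s m * C m n * s n : ℂ) * ((u m : ℂ) - (v m : ℝ) * I)
        * ((u n : ℂ) - (v n : ℝ) * I)) / 2)

theorem integral_exp_sum_mul_Iic {ι : Type*} [Fintype ι] {a : ι → ℂ} (ha : ∀ n, 0 < (a n).re)
    (β : ι → ℝ) :
    ∫ y in {y : ι → ℝ | ∀ n, y n ≤ β n}, cexp (∑ n, a n * y n)
      = (∏ n, a n)⁻¹ * cexp (∑ n, a n * β n) := by
  have hS : {y : ι → ℝ | ∀ n, y n ≤ β n} = Set.univ.pi fun n => Set.Iic (β n) := by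
    ext; simp [Pi.le_def]
  rw [hS, volume_pi, Measure.restrict_pi_pi]
  simp only [Complex.exp_sum]
  rw [integral_fintype_prod_eq_prod (f := fun n (y : ℝ) => cexp (a n * y)),
    ← Finset.prod_inv_distrib, ← Finset.prod_mul_distrib]
  refine Finset.prod_congr rfl fun n _ => ?_
  rw [integral_exp_mul_complex_Iic (ha n), div_eq_inv_mul]

theorem integrableOn_exp_sum_mul_Iic {ι : Type*} [Fintype ι] {a : ι → ℝ} (ha : ∀ n, 0 < a n)
    (β : ι → ℝ) :
    IntegrableOn (fun y : ι → ℝ => rexp (∑ n, a n * y n)) {y | ∀ n, y n ≤ β n} := by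
  have hS : {y : ι → ℝ | ∀ n, y n ≤ β n} = Set.univ.pi fun n => Set.Iic (β n) := by
    ext; simp [Pi.le_def]
  rw [hS, IntegrableOn, volume_pi, Measure.restrict_pi_pi]
  simp only [Real.exp_sum]
  exact Integrable.fintype_prod (f := fun n (y : ℝ) => rexp (a n * y))
    fun n => integrableOn_exp_mul_Iic (ha n) _

theorem orthantIntegrand_spec {N : ℕ} {C : Matrix (Fin N) (Fin N) ℝ} (hC : C.PosDef)
    {s : Fin N → ℝ} (hs : ∀ n, 0 < s n) {w : ℝ} (hw : w ^ 2 = 1) (b : Fin N → ℝ)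
    {ω : Fin N → ℝ} (hω : ∀ n, 0 < ω n) :
    Integrable (orthantIntegrand C s b (fun n => w * ω n)) ∧
    (w : ℂ) ^ N / (2 * π * I) ^ N * ∫ u, orthantIntegrand C s b (fun n => w * ω n) u
      = multinormalCDF (fun n => w * b n) C := by
  obtain ⟨B, hB, hCB⟩ := hC.exists_det_ne_zero_transpose_mul_self
  have hwC : (w : ℂ) ^ 2 = 1 := by exact_mod_cast hw
  have hw0 : w ≠ 0 := by rintro rfl; norm_num at hw
  set ξ : (Fin N → ℝ) → Fin N → ℂ := fun u n => (u n : ℂ) - (w * ω n : ℝ) * I with hξ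
  set a : (Fin N → ℝ) → Fin N → ℂ := fun u n => I * w * s n * ξ u n with ha
  have hare (u n) : (a u n).re = s n * ω n := by
    have : a u n = I * w * s n * u n + ((s n * ω n : ℝ) : ℂ) := by
      simp only [ha, hξ]
      push_cast
      linear_combination (s n * ω n : ℂ) * hwC - (w ^ 2 * s n * ω n : ℂ) * I_sq
    rw [this]; simp
  set S : Set (Fin N → ℝ) := {y | ∀ n, y n ≤ w * b n} with hSdef
  set M : Matrix (Fin N) (Fin N) ℝ := B * diagonal s with hMdef
  have hs0 : ∏ n, s n ≠ 0 := Finset.prod_ne_zero_iff.2 fun n _ => (hs n).ne'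
  have hMdet : M.det = B.det * ∏ n, s n := by simp [hMdef]
  have hM : M.det ≠ 0 := by rw [hMdet]; exact mul_ne_zero hB hs0
  set E : (Fin N → ℝ) → ℂ := fun u => cexp (-(∑ k, (∑ n, (M k n : ℂ) * ξ u n) ^ 2) / 2) with hE
  have hquad (u) : ∑ m, ∑ n, (s m * C m n * s n : ℂ) * ξ u m * ξ u n
      = ∑ k, (∑ n, (M k n : ℂ) * ξ u n) ^ 2 := by
    have hC' (m n) : C m n = ∑ k, B k m * B k n := by
      rw [hCB]; simp [Matrix.mul_apply]
    have hM' (k n) : M k n = B k n * s n := by simp [hMdef]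
    simp only [sq, Finset.sum_mul_sum]
    conv_rhs => rw [Finset.sum_comm]
    refine Finset.sum_congr rfl fun m _ => ?_
    conv_rhs => rw [Finset.sum_comm]
    refine Finset.sum_congr rfl fun n _ => ?_
    rw [hC']
    push_cast
    simp only [hM', Finset.mul_sum, Finset.sum_mul]
    refine Finset.sum_congr rfl fun k _ => ?_
    push_cast
    ring
  have hEint : Integrable E := by
    simpa [hE, hξ, neg_div] using integrable_cexp_gaussian_shift hM (fun n => w * ω n) 0
  have hF (u) : orthantIntegrand C s b (fun n => w * ω n) u
      = (∏ n, I * w * s n) * ∫ y in S, cexp (∑ n, a u n * y n) * E u := by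
    rw [integral_mul_const,
      integral_exp_sum_mul_Iic (fun n => by rw [hare]; exact mul_pos (hs n) (hω n)),
      orthantIntegrand]
    have hne : ∏ n, (I * w * s n : ℂ) ≠ 0 := by
      refine Finset.prod_ne_zero_iff.2 fun n _ => ?_
      simp [hw0, (hs n).ne']
    have h1 : ∏ n, a u n = (∏ n, (I * w * s n : ℂ)) * ∏ n, ξ u n := by
      rw [← Finset.prod_mul_distrib]
    rw [h1, mul_inv, ← mul_assoc, ← mul_assoc, ← mul_assoc, mul_inv_cancel₀ hne, one_mul, mul_assoc,
      ← Complex.exp_add]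
    congr 2
    rw [hquad, neg_div, ← sub_eq_add_neg, Finset.mul_sum]
    congr 1
    refine Finset.sum_congr rfl fun n _ => ?_
    simp only [ha, hξ]
    push_cast
    linear_combination (-(I * b n * s n * (u n - w * ω n * I))) * hwC
  have hG (y : Fin N → ℝ) (u) : cexp (∑ n, a u n * y n) * E u
      = cexp (I * ∑ k, ((w * (B⁻¹ᵀ *ᵥ y) k : ℝ) : ℂ) * ∑ n, (M k n : ℂ) * ξ u n
        - (∑ k, (∑ n, (M k n : ℂ) * ξ u n) ^ 2) / 2) := by
    rw [hE, ← Complex.exp_add, neg_div, ← sub_eq_add_neg]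
    congr 2
    have hy (n) : ∑ k, (B⁻¹ᵀ *ᵥ y) k * M k n = y n * s n := by
      change ((B⁻¹ᵀ *ᵥ y) ᵥ* M) n = _
      rw [hMdef, mulVec_transpose, vecMul_vecMul, ← Matrix.mul_assoc,
        nonsing_inv_mul _ (isUnit_iff_ne_zero.2 hB), Matrix.one_mul, vecMul_diagonal]
    simp only [Finset.mul_sum]
    rw [Finset.sum_comm]
    refine Finset.sum_congr rfl fun n _ => ?_
    have := congrArg (fun x : ℝ => (x : ℂ)) (hy n)
    push_cast at this
    simp only [ha]
    rw [show I * w * s n * ξ u n * y n = I * w * ξ u n * (y n * s n : ℂ) by ring, ← this,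
      Finset.mul_sum]
    refine Finset.sum_congr rfl fun k _ => ?_
    push_cast
    ring
  have hGint : Integrable (fun z : (Fin N → ℝ) × (Fin N → ℝ) =>
      cexp (∑ n, a z.1 n * z.2 n) * E z.1) (volume.prod (volume.restrict S)) := by
    have hR := integrableOn_exp_sum_mul_Iic (fun n => mul_pos (hs n) (hω n)) (fun n => w * b n)
    refine (hEint.norm.mul_prod hR).mono ?_ (.of_forall fun z => ?_)
    · refine Continuous.aestronglyMeasurable ?_
      simp only [hE, ha, hξ]
      fun_prop
    · rw [norm_mul, Complex.norm_exp, Real.norm_of_nonneg (by positivity), mul_comm]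
      refine le_of_eq ?_
      congr 2
      rw [Complex.re_sum]
      refine Finset.sum_congr rfl fun n _ => ?_
      rw [Complex.re_mul_ofReal, hare]
  refine ⟨?_, ?_⟩
  · rw [funext hF]
    exact hGint.integral_prod_left.const_mul _
  simp only [hF]
  rw [integral_const_mul, integral_integral_swap hGint]
  simp only [hG]
  have hI (y : Fin N → ℝ) := integral_cexp_gaussian_shift hM (fun n => w * ω n)
    (fun k => ((w * (B⁻¹ᵀ *ᵥ y) k : ℝ) : ℂ))
  have hy (y : Fin N → ℝ) : ∑ k, ((w * (B⁻¹ᵀ *ᵥ y) k : ℝ) : ℂ) ^ 2 = ((y ⬝ᵥ C⁻¹ *ᵥ y : ℝ) : ℂ) := by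
    have h : y ⬝ᵥ C⁻¹ *ᵥ y = ∑ k, ((B⁻¹ᵀ *ᵥ y) k) ^ 2 := by
      rw [hCB, Matrix.mul_inv_rev, ← mulVec_mulVec, dotProduct_mulVec, ← mulVec_transpose,
        ← transpose_nonsing_inv]
      simp [dotProduct, sq]
    rw [h]
    push_cast
    simp only [mul_pow, hwC, one_mul]
  simp only [hξ, hI, hy, multinormalCDF]
  rw [integral_const_mul, integral_const_mul]
  have hdet : C.det = B.det ^ 2 := by rw [hCB, det_mul, det_transpose, sq]
  have hexp : ∫ y in S, cexp (-((y ⬝ᵥ C⁻¹ *ᵥ y : ℝ) : ℂ) / 2)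
      = ((∫ y in S, rexp (-(y ⬝ᵥ C⁻¹ *ᵥ y) / 2) : ℝ) : ℂ) := by
    rw [← integral_complex_ofReal]
    push_cast
    rfl
  rw [hexp]
  generalize (∫ y in S, rexp (-(y ⬝ᵥ C⁻¹ *ᵥ y) / 2)) = X
  have hsqrt : √(((2 * π) ^ N * C.det)⁻¹) = (√(2 * π) ^ N * |B.det|)⁻¹ := by
    rw [hdet, Real.sqrt_inv, Real.sqrt_mul (by positivity), Real.sqrt_sq_eq_abs]
    congr 2
    rw [Real.sqrt_eq_iff_eq_sq (by positivity) (by positivity), ← pow_mul, mul_comm N, pow_mul,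
      Real.sq_sqrt (by positivity)]
  have h2 : (2 * π : ℂ) = (√(2 * π) : ℂ) ^ 2 := by
    exact_mod_cast (Real.sq_sqrt (by positivity)).symm
  have h3 : (√(2 * π) : ℂ) ≠ 0 := by
    exact_mod_cast (Real.sqrt_pos.2 (by positivity)).ne'
  have hprod : (∏ n, s n) = |∏ n, s n| := (abs_of_pos (Finset.prod_pos fun n _ => hs n)).symm
  rw [hsqrt, hMdet, abs_mul, ← hprod, h2, Finset.prod_mul_distrib, Finset.prod_mul_distrib]
  simp only [Finset.prod_const, Finset.card_univ, Fintype.card_fin]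
  push_cast
  have h4 : (∏ n, (s n : ℂ)) ≠ 0 := by exact_mod_cast hs0
  have h5 : ((|B.det| : ℝ) : ℂ) ≠ 0 := by simpa using hB
  have h6 : (w : ℂ) ^ N * w ^ N = 1 := by rw [← mul_pow, ← sq, hwC, one_pow]
  field_simp
  linear_combination (X : ℂ) * I ^ N * √(2 * π) ^ (N * 2) * h6

section Overlap
variable {ι J 𝕜 : Type*} [Fintype ι]

theorem sum_overlap_mul_mul [CommRing 𝕜] (K : Finset J) (d : J → 𝕜) (R : ι → J → Prop)
    [∀ n j, Decidable (R n j)] (x : ι → 𝕜) :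
    ∑ m, ∑ n, (∑ j ∈ K with R m j ∧ R n j, d j) * x m * x n
      = ∑ j ∈ K, d j * (∑ n with R n j, x n) ^ 2 := by
  simp only [sq, Finset.sum_filter, Finset.sum_mul_sum]
  simp only [Finset.mul_sum, Finset.sum_mul]
  conv_rhs => rw [Finset.sum_comm]
  refine Finset.sum_congr rfl fun m _ => ?_
  conv_rhs => rw [Finset.sum_comm]
  refine Finset.sum_congr rfl fun n _ => Finset.sum_congr rfl fun j _ => ?_
  by_cases hm : R m j <;> by_cases hn : R n j <;> simp [hm, hn, mul_assoc]

theorem sum_overlap_mul [CommRing 𝕜] (K : Finset J) (d : J → 𝕜) (R : ι → J → Prop)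
    [∀ n j, Decidable (R n j)] (x : ι → 𝕜) :
    ∑ n, (∑ j ∈ K with R n j, d j) * x n = ∑ j ∈ K, d j * ∑ n with R n j, x n := by
  simp only [Finset.sum_filter, Finset.mul_sum, Finset.sum_mul]
  rw [Finset.sum_comm]
  simp only [ite_mul, mul_ite, zero_mul, mul_zero]

theorem posDef_of_overlap {C : Matrix ι ι ℝ} {s : ι → ℝ} (hs : ∀ n, 0 < s n) {K : Finset J}
    {d : J → ℝ} (hd : ∀ j, 0 < d j) {R : ι → J → Prop} [∀ n j, Decidable (R n j)]
    (hC : ∀ m n, s m * C m n * s n = ∑ j ∈ K with R m j ∧ R n j, d j)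
    (hR : ∀ x : ι → ℝ, (∀ j ∈ K, ∑ n with R n j, x n = 0) → x = 0) : C.PosDef := by
  have hC' (m n) : C m n = (∑ j ∈ K with R m j ∧ R n j, d j) * (s m)⁻¹ * (s n)⁻¹ := by
    rw [← hC]; field_simp [(hs m).ne', (hs n).ne']
  refine .of_dotProduct_mulVec_pos ?_ fun x hx => ?_
  · ext m n
    simp only [conjTranspose_apply, star_trivial, hC', and_comm]
    ring
  · have h : star x ⬝ᵥ C *ᵥ x = ∑ j ∈ K, d j * (∑ n with R n j, (s n)⁻¹ * x n) ^ 2 := by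
      rw [← sum_overlap_mul_mul]
      simp only [dotProduct, mulVec, star_trivial, Finset.mul_sum, hC']
      refine Finset.sum_congr rfl fun m _ => Finset.sum_congr rfl fun n _ => ?_
      ring
    rw [h]
    refine (Finset.sum_nonneg fun j _ => mul_nonneg (hd j).le (sq_nonneg _)).lt_of_ne' ?_
    intro h0
    rw [Finset.sum_eq_zero_iff_of_nonneg fun j _ => mul_nonneg (hd j).le (sq_nonneg _)] at h0
    refine hx (funext fun n => ?_)
    have := congrFun (hR (fun n => (s n)⁻¹ * x n) fun j hj => by
      simpa [(hd j).ne'] using h0 j hj) n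
    simpa [(hs n).ne'] using this

theorem gaussian_exponent_of_overlap {C : Matrix ι ι ℝ} {s b : ι → ℝ} {K : Finset J} {d : J → ℝ}
    {R : ι → J → Prop} [∀ n j, Decidable (R n j)] {κ σ : ℝ}
    (hC : ∀ m n, s m * C m n * s n = σ ^ 2 * ∑ j ∈ K with R m j ∧ R n j, d j)
    (hb : ∀ n, b n * s n = κ * ∑ j ∈ K with R n j, d j) (ξ : ι → ℂ) :
    I * ∑ n, (b n : ℂ) * s n * ξ n - (∑ m, ∑ n, (s m * C m n * s n : ℂ) * ξ m * ξ n) / 2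
      = ∑ j ∈ K, (d j : ℂ) * (I * κ * (∑ n with R n j, ξ n)
          - σ ^ 2 / 2 * (∑ n with R n j, ξ n) ^ 2) := by
  have h1 : ∑ n, (b n : ℂ) * s n * ξ n = κ * ∑ j ∈ K, (d j : ℂ) * ∑ n with R n j, ξ n := by
    rw [← sum_overlap_mul, Finset.mul_sum]
    refine Finset.sum_congr rfl fun n _ => ?_
    have := congrArg (fun x : ℝ => (x : ℂ)) (hb n)
    push_cast at this
    rw [this, mul_assoc]
  have h2 : ∑ m, ∑ n, (s m * C m n * s n : ℂ) * ξ m * ξ n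
      = σ ^ 2 * ∑ j ∈ K, (d j : ℂ) * (∑ n with R n j, ξ n) ^ 2 := by
    rw [← sum_overlap_mul_mul, Finset.mul_sum]
    refine Finset.sum_congr rfl fun m _ => ?_
    rw [Finset.mul_sum]
    refine Finset.sum_congr rfl fun n _ => ?_
    have := congrArg (fun x : ℝ => (x : ℂ)) (hC m n)
    push_cast at this
    rw [this]
    ring
  rw [h1, h2]
  simp only [mul_sub, Finset.sum_sub_distrib, Finset.mul_sum (s := K), Finset.sum_div]
  congr 1 <;> refine Finset.sum_congr rfl fun j _ => ?_ <;> ring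

theorem eq_zero_of_sum_le_eq_zero {A : Type*} [AddCommMonoid A] [LinearOrder ι] {x : ι → A}
    (h : ∀ n, ∑ m with m ≤ n, x m = 0) : x = 0 := by
  funext n
  induction n using WellFoundedLT.induction with
  | ind n ih =>
    rw [Pi.zero_apply, ← h n, Finset.sum_eq_single n (fun m hm hmn =>
      ih m (lt_of_le_of_ne (Finset.mem_filter.1 hm).2 hmn)) (by simp)]

end Overlap

theorem sum_Iic_succ_sub_castSucc {M : ℕ} (T : Fin (M + 1) → ℝ) (p : Fin M) :
    ∑ j ∈ Finset.Iic p, (T j.succ - T j.castSucc) = T p.succ - T 0 := by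
  obtain _ | M := M
  · exact p.elim0
  induction p using Fin.induction with
  | zero =>
    rw [show Finset.Iic (0 : Fin (M + 1)) = {0} by ext; simp]
    simp
  | succ i ih =>
    rw [show Finset.Iic i.succ = insert i.succ (Finset.Iic i.castSucc) by
      ext j; simp [Fin.le_iff_val_le_val, Fin.ext_iff]; omega,
      Finset.sum_insert (by simp [Fin.le_iff_val_le_val]), ih]
    rw [← Fin.succ_castSucc]
    ring

theorem sum_Ioc_succ_sub_castSucc {M : ℕ} (T : Fin (M + 1) → ℝ) {q p : Fin M} (h : q ≤ p) :
    ∑ j ∈ Finset.Ioc q p, (T j.succ - T j.castSucc) = T p.succ - T q.succ := by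
  have h1 : Finset.Iic p = Finset.Iic q ∪ Finset.Ioc q p := by
    ext j; simp only [Finset.mem_Iic, Finset.mem_union, Finset.mem_Ioc]; omega
  have h2 := sum_Iic_succ_sub_castSucc T p
  rw [h1, Finset.sum_union (Finset.disjoint_left.2 (by simp +contextual)),
    sum_Iic_succ_sub_castSucc] at h2
  linarith

/-- The indices other than `p` are those below `p` and those above `p`. -/
noncomputable def belowAboveEquiv {M : ℕ} (p : Fin M) :
    Fin p.1 ⊕ Fin (M - p.1 - 1) ≃ {n : Fin M // n ≠ p} :=
  Equiv.ofBijective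
    (Sum.elim (fun m => ⟨Fin.castLE p.isLt.le m, by simp [Fin.ext_iff, m.isLt.ne]⟩)
      fun k => ⟨shiftEmb M p k, by simp [Fin.ext_iff, shiftEmb]; omega⟩) <| by
    constructor
    · rintro (m | m) (n | n) h <;> simp [Fin.ext_iff, shiftEmb] at h ⊢ <;> omega
    · rintro ⟨n, hn⟩
      rcases lt_or_gt_of_ne hn with h | h
      · exact ⟨.inl ⟨n, h⟩, rfl⟩
      · refine ⟨.inr ⟨n - p.1 - 1, by omega⟩, ?_⟩
        simp [Fin.ext_iff, shiftEmb]; omega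

section Split
variable {ι κ₁ κ₂ : Type*} [Fintype ι] [Fintype κ₁] [Fintype κ₂]

theorem measurePreserving_comp_inl_inr (e : κ₁ ⊕ κ₂ ≃ ι) :
    ∃ f : (ι → ℝ) ≃ᵐ (κ₁ → ℝ) × (κ₂ → ℝ), MeasurePreserving f ∧
      ∀ u, f u = (fun m => u (e (.inl m)), fun k => u (e (.inr k))) := by
  refine ⟨(MeasurableEquiv.piCongrLeft (fun _ => ℝ) e).symm.trans
    (MeasurableEquiv.sumPiEquivProdPi fun _ => ℝ),
    ((volume_measurePreserving_piCongrLeft (fun _ => ℝ) e).symm).trans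
      (volume_measurePreserving_sumPiEquivProdPi fun _ => ℝ), fun u => ?_⟩
  rfl

theorem integrable_and_integral_split (e : κ₁ ⊕ κ₂ ≃ ι) {F : (ι → ℝ) → ℂ} {c : ℂ}
    {F₁ : (κ₁ → ℝ) → ℂ} {F₂ : (κ₂ → ℝ) → ℂ}
    (hF : ∀ u, F u = c * (F₁ (fun m => u (e (.inl m))) * F₂ fun k => u (e (.inr k))))
    (h₁ : Integrable F₁) (h₂ : Integrable F₂) :
    Integrable F ∧ ∫ u, F u = c * ((∫ u, F₁ u) * ∫ u, F₂ u) := by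
  obtain ⟨f, hf, hfu⟩ := measurePreserving_comp_inl_inr e
  have hF' : F = fun u => c * ((fun z : (κ₁ → ℝ) × (κ₂ → ℝ) => F₁ z.1 * F₂ z.2) (f u)) := by
    funext u; rw [hF, hfu]
  constructor
  · rw [hF']
    exact ((hf.integrable_comp_emb f.measurableEmbedding).2 (h₁.mul_prod h₂)).const_mul c
  · rw [hF', integral_const_mul,
      hf.integral_comp' (g := fun z : (κ₁ → ℝ) × (κ₂ → ℝ) => F₁ z.1 * F₂ z.2),
      ← integral_prod_mul]
    rfl

end Split

theorem sqrt_mul_sqrt_div_mul_sqrt {x y : ℝ} (hx : 0 < x) (hy : 0 < y) :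
    √x * √(y / x) * √y = y := by
  rw [← Real.sqrt_mul hx.le, mul_div_cancel₀ _ hx.ne', Real.mul_self_sqrt hy.le]

theorem sqrt_mul_correlation_mul_sqrt_max {N : ℕ} {a : Fin N → ℝ} (ha : ∀ n, 0 < a n)
    (m n : Fin N) :
    √(a m) * (if m = n then 1 else if m < n then √(a n / a m) else √(a m / a n)) * √(a n)
      = a (max m n) := by
  rcases lt_trichotomy m n with hmn | rfl | hmn
  · rw [if_neg hmn.ne, if_pos hmn, max_eq_right hmn.le, sqrt_mul_sqrt_div_mul_sqrt (ha _) (ha _)]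
  · rw [if_pos rfl, max_self, mul_one, Real.mul_self_sqrt (ha _).le]
  · rw [if_neg hmn.ne', if_neg hmn.not_gt, max_eq_left hmn.le]
    linear_combination sqrt_mul_sqrt_div_mul_sqrt (ha n) (ha m)

theorem sqrt_mul_correlation_mul_sqrt_min {N : ℕ} {a : Fin N → ℝ} (ha : ∀ n, 0 < a n)
    (m n : Fin N) :
    √(a m) * (if m = n then 1 else if m < n then √(a m / a n) else √(a n / a m)) * √(a n)
      = a (min m n) := by
  rcases lt_trichotomy m n with hmn | rfl | hmn
  · rw [if_neg hmn.ne, if_pos hmn, min_eq_left hmn.le]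
    linear_combination sqrt_mul_sqrt_div_mul_sqrt (ha n) (ha m)
  · rw [if_pos rfl, min_self, mul_one, Real.mul_self_sqrt (ha _).le]
  · rw [if_neg hmn.ne', if_neg hmn.not_gt, min_eq_right hmn.le,
      sqrt_mul_sqrt_div_mul_sqrt (ha _) (ha _)]

theorem orthantIntegrand_of_overlap {N : ℕ} {J : Type*} {C : Matrix (Fin N) (Fin N) ℝ}
    {a : Fin N → ℝ} (ha : ∀ n, 0 < a n) {K : Finset J} {d : J → ℝ} (hd : ∀ j, 0 < d j)
    {R : Fin N → J → Prop} [∀ n j, Decidable (R n j)] {κ σ : ℝ} (hσ : 0 < σ)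
    (hC : ∀ m n, √(a m) * C m n * √(a n) = ∑ j ∈ K with R m j ∧ R n j, d j)
    (haR : ∀ n, a n = ∑ j ∈ K with R n j, d j)
    (hR : ∀ x : Fin N → ℝ, (∀ j ∈ K, ∑ n with R n j, x n = 0) → x = 0)
    {w : ℝ} (hw : w ^ 2 = 1) {ω : Fin N → ℝ} (hω : ∀ n, 0 < ω n) :
    ∃ F : (Fin N → ℝ) → ℂ, Integrable F ∧
      (w : ℂ) ^ N / (2 * π * I) ^ N * ∫ u, F u
        = multinormalCDF (fun n => w * (κ / σ * √(a n))) C ∧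
      ∀ u, F u = (∏ n, ((u n : ℂ) - (w * ω n : ℝ) * I))⁻¹ *
        cexp (∑ j ∈ K, (d j : ℂ) *
          (I * κ * (∑ n with R n j, ((u n : ℂ) - (w * ω n : ℝ) * I))
            - σ ^ 2 / 2 * (∑ n with R n j, ((u n : ℂ) - (w * ω n : ℝ) * I)) ^ 2)) := by
  have hpos : C.PosDef := posDef_of_overlap (fun n => Real.sqrt_pos.2 (ha n)) hd hC hR
  obtain ⟨h1, h2⟩ := orthantIntegrand_spec hpos
    (fun n => mul_pos hσ (Real.sqrt_pos.2 (ha n))) hw (fun n => κ / σ * √(a n)) hω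
  refine ⟨_, h1, h2, fun u => ?_⟩
  rw [orthantIntegrand, gaussian_exponent_of_overlap (K := K) (d := d) (R := R) (κ := κ) (σ := σ)]
  · intro m n
    rw [← hC]
    ring
  · intro n
    rw [← haR]
    have := Real.mul_self_sqrt (ha n).le
    field_simp
    rw [sq, this]

theorem sum_lt_of_le {M : ℕ} {p j : Fin M} (hj : j ≤ p) (f : {n : Fin M // n ≠ p} → ℂ) :
    ∑ n with n.1 < j, f n
      = ∑ m with Fin.castLE p.isLt.le m < j, f (belowAboveEquiv p (.inl m)) := by
  rw [Finset.sum_filter, Finset.sum_filter, ← (belowAboveEquiv p).sum_comp, Fintype.sum_sum_type]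
  rw [add_eq_left.2]
  · rfl
  · refine Finset.sum_eq_zero fun k _ => if_neg ?_
    simp only [belowAboveEquiv, Equiv.ofBijective_apply, Sum.elim_inr, shiftEmb, Fin.lt_def,
      Fin.le_def] at *
    omega

theorem sum_le_of_lt {M : ℕ} {p j : Fin M} (hj : p < j) (f : {n : Fin M // n ≠ p} → ℂ) :
    ∑ n with j ≤ n.1, f n
      = ∑ k with j ≤ shiftEmb M p k, f (belowAboveEquiv p (.inr k)) := by
  rw [Finset.sum_filter, Finset.sum_filter, ← (belowAboveEquiv p).sum_comp, Fintype.sum_sum_type]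
  rw [add_eq_right.2]
  · rfl
  · refine Finset.sum_eq_zero fun k _ => if_neg ?_
    exact ((show Fin.castLE p.isLt.le k < p from k.isLt).trans hj).not_ge

/-- Factorization of a lookback term in the Gaussian case.  Here `T 0 = t` and the
paper's monitoring times `T₁ < … < T_M` are `T j.succ`; the paper's index `p` is
`p.1 + 1`, and the contour variables `ξ_n`, `n ≠ p`, are `ξ n = u n − i w ω n`. -/
theorem stmt19 {M : ℕ} (σ r : ℝ) (hσ : 0 < σ) (T : Fin (M + 1) → ℝ) (hT : StrictMono T)
    (w : ℝ) (hw : w = 1 ∨ w = -1) (p : Fin M) (ω : Fin M → ℝ)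
    (hω : ∀ n, n ≠ p → 0 < ω n)
    (ψG : ℂ → ℂ)
    (hψG : ∀ ξ, ψG ξ = Complex.I * ((σ ^ 2 / 2 - r : ℝ) : ℂ) * ξ
        + ((σ ^ 2 / 2 : ℝ) : ℂ) * ξ ^ 2) :
    Integrable (fun u : {n : Fin M // n ≠ p} → ℝ =>
      (∏ n : {n : Fin M // n ≠ p},
          ((u n : ℂ) - (w * ω n.1 : ℝ) * Complex.I))⁻¹ *
        Complex.exp (
          -(∑ j ∈ Finset.Iic p, ((T j.succ - T j.castSucc : ℝ) : ℂ) *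
              ψG ((∑ n ∈ Finset.univ.filter (fun n : {n : Fin M // n ≠ p} => n.1 < j),
                  ((u n : ℂ) - (w * ω n.1 : ℝ) * Complex.I)) - Complex.I))
          - ∑ j ∈ Finset.univ.filter (fun j : Fin M => p < j),
              ((T j.succ - T j.castSucc : ℝ) : ℂ) *
              ψG (-∑ n ∈ Finset.univ.filter (fun n : {n : Fin M // n ≠ p} => j ≤ n.1),
                  ((u n : ℂ) - (w * ω n.1 : ℝ) * Complex.I)))) ∧
    ((∏ _n : {n : Fin M // n ≠ p}, (w : ℂ)) / (2 * Real.pi * Complex.I) ^ (M - 1)) *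
      (∫ u : {n : Fin M // n ≠ p} → ℝ,
        (∏ n : {n : Fin M // n ≠ p},
            ((u n : ℂ) - (w * ω n.1 : ℝ) * Complex.I))⁻¹ *
          Complex.exp (
            -(∑ j ∈ Finset.Iic p, ((T j.succ - T j.castSucc : ℝ) : ℂ) *
                ψG ((∑ n ∈ Finset.univ.filter (fun n : {n : Fin M // n ≠ p} => n.1 < j),
                    ((u n : ℂ) - (w * ω n.1 : ℝ) * Complex.I)) - Complex.I))
            - ∑ j ∈ Finset.univ.filter (fun j : Fin M => p < j),
                ((T j.succ - T j.castSucc : ℝ) : ℂ) *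
                ψG (-∑ n ∈ Finset.univ.filter (fun n : {n : Fin M // n ≠ p} => j ≤ n.1),
                    ((u n : ℂ) - (w * ω n.1 : ℝ) * Complex.I))))
      = ((Real.exp (r * (T p.succ - T 0)) *
          multinormalCDF
            (fun m : Fin p.1 =>
              w * ((r / σ + σ / 2) *
                Real.sqrt (T p.succ - T (Fin.castLE p.isLt.le m).succ)))
            (fun m n => if m = n then 1 else if m < n then
                Real.sqrt ((T p.succ - T (Fin.castLE p.isLt.le n).succ)
                  / (T p.succ - T (Fin.castLE p.isLt.le m).succ))
              else Real.sqrt ((T p.succ - T (Fin.castLE p.isLt.le m).succ)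
                  / (T p.succ - T (Fin.castLE p.isLt.le n).succ))) *
          multinormalCDF
            (fun k : Fin (M - p.1 - 1) =>
              w * ((σ / 2 - r / σ) * Real.sqrt (T (shiftEmb M p k).succ - T p.succ)))
            (fun k l => if k = l then 1 else if k < l then
                Real.sqrt ((T (shiftEmb M p k).succ - T p.succ)
                  / (T (shiftEmb M p l).succ - T p.succ))
              else Real.sqrt ((T (shiftEmb M p l).succ - T p.succ)
                  / (T (shiftEmb M p k).succ - T p.succ))) : ℝ) : ℂ) := by
  have hw2 : w ^ 2 = 1 := by rcases hw with rfl | rfl <;> norm_num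
  have hd (j : Fin M) : 0 < T j.succ - T j.castSucc := sub_pos.2 (hT j.castSucc_lt_succ)
  have hbelow (m : Fin p.1) : Fin.castLE p.isLt.le m < p := m.isLt
  have habove (k : Fin (M - p.1 - 1)) : p < shiftEmb M p k := by
    simp only [shiftEmb, Fin.lt_def]; omega
  have hsm : StrictMono (shiftEmb M p) := fun k l h => by
    simp only [shiftEmb, Fin.lt_def] at *; omega
  have hcm : StrictMono (Fin.castLE p.isLt.le) := fun k l h => h
  obtain ⟨F₁, hF₁, hI₁, hF₁u⟩ := orthantIntegrand_of_overlap
    (C := fun m n : Fin p.1 => if m = n then 1 else if m < n then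
                √((T p.succ - T (Fin.castLE p.isLt.le n).succ)
                  / (T p.succ - T (Fin.castLE p.isLt.le m).succ))
              else √((T p.succ - T (Fin.castLE p.isLt.le m).succ)
                  / (T p.succ - T (Fin.castLE p.isLt.le n).succ)))
    (a := fun m => T p.succ - T (Fin.castLE p.isLt.le m).succ)
    (K := Finset.Iic p) (d := fun j => T j.succ - T j.castSucc)
    (R := fun m j => Fin.castLE p.isLt.le m < j) (κ := r + σ ^ 2 / 2)
    (ω := fun m => ω (Fin.castLE p.isLt.le m))
    (fun m => sub_pos.2 (hT (Fin.succ_lt_succ_iff.2 (hbelow m)))) hd hσ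
    (fun m n => by
      rw [sqrt_mul_correlation_mul_sqrt_max
        (a := fun m => T p.succ - T (Fin.castLE p.isLt.le m).succ)
        (fun m => sub_pos.2 (hT (Fin.succ_lt_succ_iff.2 (hbelow m)))),
        ← sum_Ioc_succ_sub_castSucc T (hbelow (max m n)).le]
      refine Finset.sum_congr ?_ fun _ _ => rfl
      ext j
      simp [hcm.monotone.map_max, and_comm])
    (fun m => by
      rw [← sum_Ioc_succ_sub_castSucc T (hbelow m).le]
      refine Finset.sum_congr ?_ fun _ _ => rfl
      ext j
      simp [and_comm])
    (fun x hx => eq_zero_of_sum_le_eq_zero fun n => by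
      rw [← hx ⟨n + 1, by omega⟩ (by simp [Fin.le_def])]
      refine Finset.sum_congr ?_ fun _ _ => rfl
      ext m
      simp only [Finset.mem_filter, Finset.mem_univ, true_and, Fin.lt_def, Fin.val_castLE,
        Nat.lt_succ_iff]
      rfl) hw2 (fun m => hω _ (hbelow m).ne)
  obtain ⟨F₂, hF₂, hI₂, hF₂u⟩ := orthantIntegrand_of_overlap
    (C := fun k l : Fin (M - p.1 - 1) => if k = l then 1 else if k < l then
                √((T (shiftEmb M p k).succ - T p.succ) / (T (shiftEmb M p l).succ - T p.succ))
              else √((T (shiftEmb M p l).succ - T p.succ)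
                  / (T (shiftEmb M p k).succ - T p.succ)))
    (a := fun k => T (shiftEmb M p k).succ - T p.succ)
    (K := Finset.univ.filter fun j : Fin M => p < j) (d := fun j => T j.succ - T j.castSucc)
    (R := fun k j => j ≤ shiftEmb M p k) (κ := σ ^ 2 / 2 - r)
    (ω := fun k => ω (shiftEmb M p k))
    (fun k => sub_pos.2 (hT (Fin.succ_lt_succ_iff.2 (habove k)))) hd hσ
    (fun k l => by
      rw [sqrt_mul_correlation_mul_sqrt_min
        (a := fun k => T (shiftEmb M p k).succ - T p.succ)
        (fun k => sub_pos.2 (hT (Fin.succ_lt_succ_iff.2 (habove k)))),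
        ← sum_Ioc_succ_sub_castSucc T (habove (min k l)).le]
      refine Finset.sum_congr ?_ fun _ _ => rfl
      ext j
      simp [hsm.monotone.map_min])
    (fun k => by
      rw [← sum_Ioc_succ_sub_castSucc T (habove k).le]
      refine Finset.sum_congr ?_ fun _ _ => rfl
      ext j
      simp)
    (fun x hx => eq_zero_of_sum_le_eq_zero (ι := (Fin (M - p.1 - 1))ᵒᵈ) fun n => by
      rw [← hx (shiftEmb M p n) (by simpa using habove n)]
      refine Finset.sum_congr ?_ fun _ _ => rfl
      ext m
      exact ⟨fun h => Finset.mem_filter.2 ⟨Finset.mem_univ _,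
          hsm.monotone (Finset.mem_filter.1 h).2⟩,
        fun h => Finset.mem_filter.2 ⟨Finset.mem_univ _,
          hsm.le_iff_le.1 (Finset.mem_filter.1 h).2⟩⟩) hw2 (fun k => hω _ (habove k).ne')
  have hinl (m) : (belowAboveEquiv p (.inl m)).1 = Fin.castLE p.isLt.le m := rfl
  have hinr (k) : (belowAboveEquiv p (.inr k)).1 = shiftEmb M p k := rfl
  have hF := integrable_and_integral_split (belowAboveEquiv p)
    (c := cexp (r * (T p.succ - T 0))) (F₁ := F₁) (F₂ := F₂) (F := fun u =>
      (∏ n : {n : Fin M // n ≠ p}, ((u n : ℂ) - (w * ω n.1 : ℝ) * Complex.I))⁻¹ *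
        Complex.exp (
          -(∑ j ∈ Finset.Iic p, ((T j.succ - T j.castSucc : ℝ) : ℂ) *
              ψG ((∑ n ∈ Finset.univ.filter (fun n : {n : Fin M // n ≠ p} => n.1 < j),
                  ((u n : ℂ) - (w * ω n.1 : ℝ) * Complex.I)) - Complex.I))
          - ∑ j ∈ Finset.univ.filter (fun j : Fin M => p < j),
              ((T j.succ - T j.castSucc : ℝ) : ℂ) *
              ψG (-∑ n ∈ Finset.univ.filter (fun n : {n : Fin M // n ≠ p} => j ≤ n.1),
                  ((u n : ℂ) - (w * ω n.1 : ℝ) * Complex.I)))) (fun u => by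
    rw [hF₁u, hF₂u, ← (belowAboveEquiv p).prod_comp, Fintype.prod_sum_type, mul_inv,
      mul_mul_mul_comm, ← Complex.exp_add, mul_left_comm, ← Complex.exp_add]
    congr 2
    rw [sub_eq_add_neg, ← add_assoc]
    congr 1
    · have hsum : (r * (T p.succ - T 0) : ℂ)
          = ∑ j ∈ Finset.Iic p, ((T j.succ - T j.castSucc : ℝ) : ℂ) * r := by
        rw [← Finset.sum_mul, ← ofReal_sum, sum_Iic_succ_sub_castSucc]
        push_cast
        ring
      rw [hsum, ← Finset.sum_add_distrib, ← Finset.sum_neg_distrib]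
      refine Finset.sum_congr rfl fun j hj => ?_
      rw [sum_lt_of_le (Finset.mem_Iic.1 hj), hψG]
      simp only [hinl]
      generalize ∑ m with Fin.castLE p.isLt.le m < j,
        ((u (belowAboveEquiv p (.inl m)) : ℂ) - (w * ω (Fin.castLE p.isLt.le m) : ℝ) * I) = S
      push_cast
      linear_combination (T j.succ - T j.castSucc : ℂ) * (σ ^ 2 / 2 - r - σ ^ 2 / 2) * I_sq
    · rw [← Finset.sum_neg_distrib]
      refine Finset.sum_congr rfl fun j hj => ?_
      rw [sum_le_of_lt (Finset.mem_filter.1 hj).2, hψG]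
      simp only [hinr]
      generalize ∑ k with j ≤ shiftEmb M p k,
        ((u (belowAboveEquiv p (.inr k)) : ℂ) - (w * ω (shiftEmb M p k) : ℝ) * I) = S
      push_cast
      ring) hF₁ hF₂
  refine ⟨hF.1, ?_⟩
  rw [hF.2]
  have hM : M - 1 = p.1 + (M - p.1 - 1) := by omega
  have hκ₁ : (r + σ ^ 2 / 2) / σ = r / σ + σ / 2 := by field_simp
  have hκ₂ : (σ ^ 2 / 2 - r) / σ = σ / 2 - r / σ := by field_simp
  simp only [hκ₁, mul_assoc] at hI₁
  simp only [hκ₂, mul_assoc] at hI₂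
  rw [ofReal_mul, ofReal_mul, ← hI₁, ← hI₂]
  have hcard : Fintype.card {n : Fin M // n ≠ p} = M - 1 := by simp
  rw [Finset.prod_const, Finset.card_univ, hcard, hM, pow_add, pow_add]
  push_cast
  simp only [mul_assoc]
  ring
end
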